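/- arXiv:2210.01858 — 4 statements merged into one kernel-verified Lean document; each statement's English description precedes it below -/
import Mathlib

section
/- The (3!)^3 = 216 preference triads on 3 alternatives are partitioned by the equivalence relation ∼ into exactly 10 equivalence classes; that is, the quotient of the set of all functions Fin 3 → Equiv.Perm (Fin 3) by ∼ has cardinality 10. -/
/-- Two preference triads `P Q : Fin 3 → Equiv.Perm (Fin n)` are related if there is a
relabeling `ρ` of the nodes and a relabeling `τ` of the alternatives with
`Q i = τ * P (ρ i)` for all `i`. -/
def prefRel (n : ℕ) (P Q : Fin 3 → Equiv.Perm (Fin n)) : Prop :=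
  ∃ (ρ : Equiv.Perm (Fin 3)) (τ : Equiv.Perm (Fin n)), ∀ i : Fin 3, Q i = τ * P (ρ i)

/-- A numerical code of a permutation of `Fin 3`. -/
def codeP (p : Equiv.Perm (Fin 3)) : ℕ := 3 * (p 0).val + (p 1).val

/-- An invariant of preference triads. -/
def invP (P : Fin 3 → Equiv.Perm (Fin 3)) : ℕ := ∑ i, ∏ j, codeP ((P i)⁻¹ * P j)

/-- The ten representatives. -/
def repP : Fin 10 → Fin 3 → Equiv.Perm (Fin 3) :=
  ![![1, 1, 1], ![1, 1, Equiv.swap 0 1], ![1, 1, Equiv.swap 0 2], ![1, 1, Equiv.swap 1 2],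
    ![1, 1, Equiv.swap 0 1 * Equiv.swap 1 2], ![1, 1, Equiv.swap 1 2 * Equiv.swap 0 1],
    ![1, Equiv.swap 0 1 * Equiv.swap 1 2, Equiv.swap 1 2 * Equiv.swap 0 1],
    ![1, Equiv.swap 0 1, Equiv.swap 0 2], ![1, Equiv.swap 0 1, Equiv.swap 1 2],
    ![1, Equiv.swap 0 2, Equiv.swap 1 2]]

theorem invP_eq {P Q : Fin 3 → Equiv.Perm (Fin 3)} (h : prefRel 3 P Q) : invP P = invP Q := by
  obtain ⟨ρ, τ, h⟩ := h
  have e : ∀ i j, (Q i)⁻¹ * Q j = (P (ρ i))⁻¹ * P (ρ j) := by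
    intro i j; rw [h, h]; group
  unfold invP
  simp only [e]
  rw [← Equiv.sum_comp ρ]
  refine Finset.sum_congr rfl fun i _ => ?_
  rw [← Equiv.prod_comp ρ]

theorem repP_inj : ∀ k l : Fin 10, invP (repP k) = invP (repP l) → k = l := by
  decide +kernel

theorem repP_surj : ∀ a b : Equiv.Perm (Fin 3), ∃ k : Fin 10,
    ∃ (ρ τ : Equiv.Perm (Fin 3)), ∀ i : Fin 3, repP k i = τ * (![1, a, b] : Fin 3 → Equiv.Perm (Fin 3)) (ρ i) := by
  decide +kernel

/-- The 216 preference triads on 3 alternatives fall into exactly 10 equivalence classes. -/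
theorem card_quot_prefRel_three : Nat.card (Quot (prefRel 3)) = 10 := by
  have hb : Function.Bijective (fun k : Fin 10 => Quot.mk (prefRel 3) (repP k)) := by
    constructor
    · intro k l hkl
      exact repP_inj k l (congrArg (Quot.lift invP fun _ _ h => invP_eq h) hkl)
    · intro q
      induction q using Quot.ind with
      | mk P =>
        obtain ⟨k, ρ, τ, h⟩ := repP_surj ((P 0)⁻¹ * P 1) ((P 0)⁻¹ * P 2)
        refine ⟨k, (Quot.sound ⟨ρ, τ * (P 0)⁻¹, fun i => ?_⟩).symm⟩
        rw [h i, mul_assoc]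
        congr 1
        generalize ρ i = j
        fin_cases j <;> simp
  rw [← Nat.card_congr (Equiv.ofBijective _ hb)]
  simp
end

section
/- Let n ≥ 2 and let ℓ_n denote the number of elements of order 3 in the symmetric group on n elements, i.e., ℓ_n = card {g : Equiv.Perm (Fin n) | orderOf g = 3}. Then the number of equivalence classes of preference triads on n alternatives under ∼ equals (n! · (n! + 3) + 2 · (ℓ_n + 1)) / 6. -/
section Helpers

variable {H : Type} [Group H]

/-- Triads, as a fresh type. -/
def PTriad (H : Type) : Type := Fin 3 → H

instance ptriadAction : MulAction (Equiv.Perm (Fin 3) × H) (PTriad H) where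
  smul g P := fun i => g.2 * P (g.1⁻¹ i)
  one_smul P := by
    funext i
    change (1 : H) * P ((1 : Equiv.Perm (Fin 3))⁻¹ i) = P i
    simp
  mul_smul g h P := by
    funext i
    change (g.2 * h.2) * P ((g.1 * h.1)⁻¹ i) = g.2 * (h.2 * P (h.1⁻¹ (g.1⁻¹ i)))
    simp [mul_assoc]

lemma ptriad_smul (g : Equiv.Perm (Fin 3) × H) (P : PTriad H) (i : Fin 3) :
    (g • P) i = g.2 * P (g.1⁻¹ i) := rfl

/-- Fixed pairs for a given node permutation. -/
def FixP (H : Type) [Group H] (σ : Equiv.Perm (Fin 3)) : Type :=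
  {x : H × (Fin 3 → H) // ∀ i, x.1 * x.2 (σ i) = x.2 i}

lemma fixP_one : Nat.card (FixP H 1) = Nat.card H ^ 3 := by
  have h : Function.Bijective (fun x : FixP H 1 => x.1.2) := by
    constructor
    · rintro ⟨⟨t, P⟩, hx⟩ ⟨⟨s, Q⟩, hy⟩ h
      simp at hx hy h
      subst hx hy h
      rfl
    · intro P
      exact ⟨⟨(1, P), by simp⟩, rfl⟩
  rw [Nat.card_eq_of_bijective _ h, Nat.card_fun]
  simp

lemma fixP_swap (σ : Equiv.Perm (Fin 3)) (a b c : Fin 3) (hab : a ≠ b) (hac : a ≠ c)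
    (hbc : b ≠ c) (hall : ∀ i, i = a ∨ i = b ∨ i = c) (ha : σ a = b) (hb : σ b = a)
    (hc : σ c = c) : Nat.card (FixP H σ) = Nat.card H ^ 2 := by
  have h : Function.Bijective (fun x : FixP H σ => (x.1.2 a, x.1.2 c)) := by
    constructor
    · rintro ⟨⟨t, P⟩, hx⟩ ⟨⟨s, Q⟩, hy⟩ h
      simp only [Prod.mk.injEq] at hx hy h
      have h1 := hx c
      have h2 := hy c
      have h3 := hx a
      have h4 := hy a
      rw [hc] at h1 h2
      rw [ha] at h3 h4
      simp at h1 h2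
      subst h1 h2
      simp at h3 h4
      have : P = Q := by
        funext i
        rcases hall i with rfl | rfl | rfl
        · exact h.1
        · rw [h3, h4]; exact h.1
        · exact h.2
      subst this
      rfl
    · rintro ⟨u, v⟩
      refine ⟨⟨(1, fun i => if i = c then v else u), ?_⟩, ?_⟩
      · intro i
        rcases hall i with rfl | rfl | rfl <;> simp [*]
      · simp [hac]
  rw [Nat.card_eq_of_bijective _ h, Nat.card_prod, sq]

lemma fixP_cyc (σ : Equiv.Perm (Fin 3)) (a b c : Fin 3) (hab : a ≠ b) (hac : a ≠ c)
    (hbc : b ≠ c) (hall : ∀ i, i = a ∨ i = b ∨ i = c) (ha : σ a = b) (hb : σ b = c)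
    (hc : σ c = a) : Nat.card (FixP H σ) = Nat.card {t : H // t ^ 3 = 1} * Nat.card H := by
  have key : ∀ x : FixP H σ, x.1.1 ^ 3 = 1 := by
    rintro ⟨⟨t, P⟩, hx⟩
    have h1 := hx a
    have h2 := hx b
    have h3 := hx c
    simp only [ha, hb, hc] at h1 h2 h3
    rw [← h2, ← h3] at h1
    have : t ^ 3 * P a = P a := by rw [pow_succ, pow_two]; simpa [mul_assoc] using h1
    simpa using this
  have h : Function.Bijective
      (fun x : FixP H σ => ((⟨x.1.1, key x⟩ : {t : H // t ^ 3 = 1}), x.1.2 a)) := by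
    constructor
    · rintro ⟨⟨t, P⟩, hx⟩ ⟨⟨s, Q⟩, hy⟩ h
      simp only [Prod.mk.injEq, Subtype.mk.injEq] at hx hy h
      obtain ⟨rfl, h⟩ := h
      have h1 := hx b
      have h2 := hx c
      have h3 := hy b
      have h4 := hy c
      simp only [hb, hc] at h1 h2 h3 h4
      have : P = Q := by
        funext i
        rcases hall i with hi | hi | hi <;> subst hi
        · exact h
        · rw [← h1, ← h3, ← h2, ← h4, h]
        · rw [← h2, ← h4, h]
      subst this
      rfl
    · rintro ⟨⟨t, ht⟩, u⟩
      refine ⟨⟨(t, fun i => if i = a then u else if i = b then t * (t * u) else t * u), ?_⟩, ?_⟩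
      · have h3 : t * (t * (t * u)) = u := by
          have : t ^ 3 * u = u := by rw [ht, one_mul]
          rw [pow_succ, pow_two] at this
          simpa [mul_assoc] using this
        intro i
        rcases hall i with hi | hi | hi <;> subst hi <;>
          simp [ha, hb, hc, h3, hab.symm, hac.symm, hbc.symm]
      · simp
  rw [Nat.card_eq_of_bijective _ h, Nat.card_prod]

lemma card_cube [Finite H] :
    Nat.card {t : H // t ^ 3 = 1} = Nat.card {g : H | orderOf g = 3} + 1 := by
  classical
  have : Fact (Nat.Prime 3) := ⟨Nat.prime_three⟩
  have h : {t : H | t ^ 3 = 1} = insert 1 {g : H | orderOf g = 3} := by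
    ext t
    simp only [Set.mem_ofPred_eq, Set.mem_insert_iff, orderOf_eq_prime_iff]
    by_cases h : t = 1 <;> simp [h]
  change Nat.card {t : H | t ^ 3 = 1} = _
  rw [h, Nat.card_coe_set_eq, Nat.card_coe_set_eq, Set.ncard_insert_of_notMem (by simp)]

lemma sum_perm3 (f : Equiv.Perm (Fin 3) → ℕ) :
    ∑ r, f r = f 1 + f (Equiv.swap 0 1) + f (Equiv.swap 0 2) + f (Equiv.swap 1 2)
      + f (finRotate 3) + f (finRotate 3)⁻¹ := by
  have : (Finset.univ : Finset (Equiv.Perm (Fin 3))) =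
      {1, Equiv.swap 0 1, Equiv.swap 0 2, Equiv.swap 1 2, finRotate 3, (finRotate 3)⁻¹} := by
    decide
  rw [this]
  repeat rw [Finset.sum_insert (by decide)]
  rw [Finset.sum_singleton]
  ring

lemma burnside_triad [Finite H] :
    Nat.card (MulAction.orbitRel.Quotient (Equiv.Perm (Fin 3) × H) (PTriad H)) * (6 * Nat.card H)
      = Nat.card H ^ 3 + 3 * Nat.card H ^ 2
        + 2 * ((Nat.card {g : H | orderOf g = 3} + 1) * Nat.card H) := by
  classical
  have : Finite (PTriad H) := inferInstanceAs (Finite (Fin 3 → H))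
  have e := Nat.card_congr
    (MulAction.sigmaFixedByEquivOrbitsProdGroup (Equiv.Perm (Fin 3) × H) (PTriad H))
  rw [Nat.card_prod, Nat.card_prod] at e
  have h6 : Nat.card (Equiv.Perm (Fin 3)) = 6 := by
    rw [Nat.card_eq_fintype_card]; decide
  rw [h6] at e
  change _ = Nat.card (MulAction.orbitRel.Quotient _ _) * _ at e
  rw [← e]
  let E : (Σ g : Equiv.Perm (Fin 3) × H, MulAction.fixedBy (PTriad H) g) ≃
      Σ r : Equiv.Perm (Fin 3), FixP H r⁻¹ :=
    { toFun := fun x => ⟨x.1.1, ⟨(x.1.2, x.2.1), fun i => congrFun x.2.2 i⟩⟩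
      invFun := fun y => ⟨(y.1, y.2.1.1), ⟨y.2.1.2, funext y.2.2⟩⟩
      left_inv := fun x => rfl
      right_inv := fun y => rfl }
  have (r : Equiv.Perm (Fin 3)) : Finite (FixP H r⁻¹) := by unfold FixP; infer_instance
  rw [Nat.card_congr E, Nat.card_sigma, sum_perm3, inv_one, fixP_one,
    fixP_swap _ 0 1 2, fixP_swap _ 0 2 1, fixP_swap _ 1 2 0,
    fixP_cyc (finRotate 3)⁻¹ 0 2 1, fixP_cyc (finRotate 3)⁻¹⁻¹ 0 1 2, card_cube]
  · ring
  all_goals decide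

end Helpers

/-- The number of equivalence classes of preference triads on `n ≥ 2` alternatives is
`(n! (n! + 3) + 2 (ℓ_n + 1)) / 6` where `ℓ_n` is the number of elements of order 3 in `S_n`. -/
theorem card_quot_prefRel (n : ℕ) (hn : 2 ≤ n) :
    Nat.card (Quot (prefRel n)) =
      (Nat.factorial n * (Nat.factorial n + 3) +
        2 * (Nat.card {g : Equiv.Perm (Fin n) | orderOf g = 3} + 1)) / 6 := by
  have hb := burnside_triad (H := Equiv.Perm (Fin n))
  have hq : Nat.card (Quot (prefRel n)) = Nat.card (MulAction.orbitRel.Quotient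
      (Equiv.Perm (Fin 3) × Equiv.Perm (Fin n)) (PTriad (Equiv.Perm (Fin n)))) := by
    refine Nat.card_congr (Quot.congr (Equiv.refl _) ?_)
    suffices key : ∀ P Q : PTriad (Equiv.Perm (Fin n)), prefRel n P Q ↔
        P ∈ MulAction.orbit (Equiv.Perm (Fin 3) × Equiv.Perm (Fin n)) Q from key
    intro P Q
    rw [MulAction.mem_orbit_symm]
    constructor
    · rintro ⟨r, t, h⟩
      refine ⟨(r⁻¹, t), ?_⟩
      funext i
      change t * P (r⁻¹⁻¹ i) = Q i
      rw [h, inv_inv]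
    · rintro ⟨⟨r, t⟩, h⟩
      exact ⟨r⁻¹, t, fun i => (congrFun h i).symm⟩
  have hN : Nat.card (Equiv.Perm (Fin n)) = n.factorial := by
    rw [Nat.card_perm, Nat.card_fin]
  rw [← hq, hN] at hb
  have hpos := Nat.factorial_pos n
  symm
  apply Nat.div_eq_of_eq_mul_left (by norm_num)
  apply Nat.eq_of_mul_eq_mul_left hpos
  linarith
end

section
/- For every n ≥ 2, 6 divides n! · (n! + 3) + 2 · (ℓ_n + 1), where ℓ_n = card {g : Equiv.Perm (Fin n) | orderOf g = 3}; hence the expression (n! · (n! + 3) + 2 · (ℓ_n + 1)) / 6 for the number of equivalence classes of preference triads is an exact integer quotient. -/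
def mcKayRot (G : Type*) [Group G] (x : G × G) : G × G := (x.2, (x.1 * x.2)⁻¹)

lemma mcKayRot_pow (G : Type*) [Group G] :
    (show Function.End (G × G) from mcKayRot G) ^ 3 ^ 1 = 1 := by
  funext x
  obtain ⟨a, b⟩ := x
  change mcKayRot G (mcKayRot G (mcKayRot G (a, b))) = (a, b)
  simp [mcKayRot]

lemma three_dvd_aux (G : Type*) [Group G] [Fintype G] [DecidableEq G]
    (h : 3 ∣ Fintype.card G) : 3 ∣ Nat.card {g : G | orderOf g = 3} + 1 := by
  classical
  have h1 := Equiv.Perm.card_fixedPoints_modEq (p := 3) (n := 1) (mcKayRot_pow G)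
  have e : Fintype.card (Function.fixedPoints (mcKayRot G)) =
      Fintype.card {g : G // g ^ 3 = 1} := by
    refine Fintype.card_congr
      { toFun := fun x => ⟨x.1.1, ?_⟩
        invFun := fun g => ⟨(g.1, g.1), ?_⟩
        left_inv := ?_
        right_inv := ?_ }
    · obtain ⟨⟨a, b⟩, hx⟩ := x
      have hx' : (b, (a * b)⁻¹) = (a, b) := hx
      simp only [Prod.mk.injEq] at hx'
      obtain ⟨rfl, h2⟩ := hx'
      have := inv_eq_iff_mul_eq_one.mp h2
      simpa [pow_succ] using this
    · obtain ⟨g, hg⟩ := g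
      change (g, (g * g)⁻¹) = (g, g)
      simp only [Prod.mk.injEq, true_and]
      apply inv_eq_iff_mul_eq_one.mpr
      simpa [pow_succ] using hg
    · rintro ⟨⟨a, b⟩, hx⟩
      have hx' : (b, (a * b)⁻¹) = (a, b) := hx
      simp only [Prod.mk.injEq] at hx'
      simp [hx'.1]
    · rintro ⟨g, hg⟩
      rfl
  have e2 : Fintype.card {g : G // g ^ 3 = 1} = Nat.card {g : G | orderOf g = 3} + 1 := by
    rw [Fintype.card_subtype, Nat.card_eq_fintype_card, Fintype.card_subtype]
    simp only [Set.mem_setOf_eq]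
    have : (Finset.univ.filter fun g : G => g ^ 3 = 1) =
        insert 1 (Finset.univ.filter fun g : G => orderOf g = 3) := by
      ext g
      simp only [Finset.mem_filter, Finset.mem_univ, true_and, Finset.mem_insert]
      rw [← orderOf_dvd_iff_pow_eq_one, Nat.dvd_prime Nat.prime_three, orderOf_eq_one_iff]
    rw [this, Finset.card_insert_of_notMem (by simp)]
  have e3 : Fintype.card (G × G) ≡ Fintype.card (Function.fixedPoints (mcKayRot G)) [MOD 3] := by
    convert h1
  rw [e, e2, Fintype.card_prod] at e3
  exact (e3.dvd_iff dvd_rfl).mp (h.mul_right _)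

/-- For `n ≥ 2`, `6` divides `n!(n!+3) + 2(ℓ_n + 1)`, where `ℓ_n` is the number of
elements of order 3 in the symmetric group on `n` elements. -/
theorem six_dvd_prefTriad_count (n : ℕ) (hn : 2 ≤ n) :
    6 ∣ Nat.factorial n * (Nat.factorial n + 3) +
      2 * (Nat.card {g : Equiv.Perm (Fin n) | orderOf g = 3} + 1) := by
  obtain rfl | h3 := hn.eq_or_lt
  · have : IsEmpty {g : Equiv.Perm (Fin 2) | orderOf g = 3} := by
      refine ⟨fun ⟨g, hg⟩ => ?_⟩
      have hg' : orderOf g = 3 := hg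
      have := orderOf_dvd_card (x := g)
      rw [hg', Fintype.card_perm] at this
      revert this
      decide
    rw [Nat.card_of_isEmpty]
    decide
  · have h6 : 6 ∣ Nat.factorial n := Nat.factorial_dvd_factorial (m := 3) h3
    have := three_dvd_aux (Equiv.Perm (Fin n)) (by
      rw [Fintype.card_perm, Fintype.card_fin]
      exact dvd_trans (by norm_num) h6)
    exact dvd_add (h6.mul_right _) (Nat.mul_dvd_mul_left 2 this)
end

section
/- The number of equivalence classes under ∼ of preference triads on 4 alternatives is 111; that is, the quotient of the set of all functions Fin 3 → Equiv.Perm (Fin 4) by ∼ has cardinality 111. -/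
/-- The triad with first entry the identity. -/
def triV (x : Equiv.Perm (Fin 4) × Equiv.Perm (Fin 4)) : Fin 3 → Equiv.Perm (Fin 4) :=
  ![1, x.1, x.2]

/-- Normalization of a triad. -/
def triN (P : Fin 3 → Equiv.Perm (Fin 4)) : Equiv.Perm (Fin 4) × Equiv.Perm (Fin 4) :=
  ((P 0)⁻¹ * P 1, (P 0)⁻¹ * P 2)

theorem triV_triN (P : Fin 3 → Equiv.Perm (Fin 4)) (i : Fin 3) :
    triV (triN P) i = (P 0)⁻¹ * P i := by
  fin_cases i <;> simp [triV, triN]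

theorem triN_triV (x : Equiv.Perm (Fin 4) × Equiv.Perm (Fin 4)) : triN (triV x) = x := by
  simp [triV, triN]

theorem triN_mul (τ : Equiv.Perm (Fin 4)) (P Q : Fin 3 → Equiv.Perm (Fin 4))
    (h : ∀ i, Q i = τ * P i) : triN Q = triN P := by
  simp [triN, h, mul_assoc]

/-- The node relabelings act on normalized triads. -/
@[reducible] def triAct :
    MulAction (Equiv.Perm (Fin 3)) (Equiv.Perm (Fin 4) × Equiv.Perm (Fin 4)) where
  smul ρ x := triN (fun i => triV x (ρ⁻¹ i))
  one_smul x := triN_triV x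
  mul_smul ρ σ x := by
    change triN (fun i => triV x ((ρ * σ)⁻¹ i)) =
      triN (fun i => triV (triN (fun j => triV x (σ⁻¹ j))) (ρ⁻¹ i))
    symm
    apply triN_mul ((triV x (σ⁻¹ 0))⁻¹)
    intro i
    rw [triV_triN, mul_inv_rev, Equiv.Perm.mul_apply]

/-- Number of normalized triads fixed by a node relabeling with values `a b c`. -/
def triG (a b c : Fin 3) : ℕ :=
  Fintype.card {x : Equiv.Perm (Fin 4) × Equiv.Perm (Fin 4) //
    ((triV x a)⁻¹ * triV x b, (triV x a)⁻¹ * triV x c) = x}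

theorem tri_sum (G : Fin 3 → Fin 3 → Fin 3 → ℕ) :
    ∑ ρ : Equiv.Perm (Fin 3), G (ρ⁻¹ 0) (ρ⁻¹ 1) (ρ⁻¹ 2) =
      G 0 1 2 + G 0 2 1 + G 1 0 2 + G 1 2 0 + G 2 0 1 + G 2 1 0 := by
  have h : (Finset.univ : Finset (Equiv.Perm (Fin 3))).val.map
      (fun ρ => (ρ⁻¹ 0, ρ⁻¹ 1, ρ⁻¹ 2)) =
      {(0, 1, 2), (0, 2, 1), (1, 0, 2), (1, 2, 0), (2, 0, 1), (2, 1, 0)} := by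
    decide +kernel
  have h2 := congrArg (fun s => (s.map (fun t : Fin 3 × Fin 3 × Fin 3 => G t.1 t.2.1 t.2.2)).sum) h
  simp only [Multiset.map_map] at h2
  refine Eq.trans h2 ?_
  simp [add_assoc]

theorem tri_cube : Fintype.card {a : Equiv.Perm (Fin 4) // a * a * a = 1} = 9 := by
  decide +kernel

theorem tri_card {p : Equiv.Perm (Fin 4) × Equiv.Perm (Fin 4) → Prop} [DecidablePred p]
    {q : Equiv.Perm (Fin 4) → Prop} [DecidablePred q]
    (f : Equiv.Perm (Fin 4) → Equiv.Perm (Fin 4) × Equiv.Perm (Fin 4))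
    (g : Equiv.Perm (Fin 4) × Equiv.Perm (Fin 4) → Equiv.Perm (Fin 4))
    (hf : ∀ a, q a → p (f a)) (hg : ∀ x, p x → q (g x) ∧ f (g x) = x)
    (hgf : ∀ a, g (f a) = a) :
    Fintype.card {x // p x} = Fintype.card {a // q a} :=
  Fintype.card_congr
    { toFun := fun x => ⟨g x.1, (hg x.1 x.2).1⟩
      invFun := fun a => ⟨f a.1, hf a.1 a.2⟩
      left_inv := fun x => Subtype.ext (hg x.1 x.2).2
      right_inv := fun a => Subtype.ext (hgf a.1) }

theorem tri_true : Fintype.card {a : Equiv.Perm (Fin 4) // a = a} = 24 := by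
  simp [Fintype.card_perm, Nat.factorial]

theorem tri_count : ∑ ρ : Equiv.Perm (Fin 3),
    Fintype.card {x : Equiv.Perm (Fin 4) × Equiv.Perm (Fin 4) //
      triN (fun i => triV x (ρ⁻¹ i)) = x} = 666 := by
  have h1 : triG 0 1 2 = 576 := by
    simp [triG, triV, Fintype.card_perm, Nat.factorial]
  have h2 : triG 0 2 1 = 24 := by
    rw [← tri_true]
    refine tri_card (fun a => (a, a)) (fun x => x.1) ?_ ?_ ?_ <;>
      simp [triV]
  have h3 : triG 1 0 2 = 24 := by
    rw [← tri_true]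
    refine tri_card (fun a => (1, a)) (fun x => x.2) ?_ ?_ ?_ <;>
      simp +contextual [triV]
  have h4 : triG 2 1 0 = 24 := by
    rw [← tri_true]
    refine tri_card (fun a => (a, 1)) (fun x => x.1) ?_ ?_ ?_ <;>
      simp +contextual [triV]
  have h5 : triG 1 2 0 = 9 := by
    rw [← tri_cube]
    refine tri_card (fun a => (a, a⁻¹)) (fun x => x.1) ?_ ?_ ?_ <;>
      simp +contextual [triV]
    · intro a h
      have h' : a⁻¹ = a * a := (eq_inv_of_mul_eq_one_left h).symm
      rw [h', ← mul_assoc, h, one_mul]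
    · intro a b h h'
      have h3 : b = a * a := by rw [← inv_mul_eq_iff_eq_mul, h]
      rw [← h3, ← h', inv_mul_cancel]
  have h6 : triG 2 0 1 = 9 := by
    rw [← tri_cube]
    refine tri_card (fun a => (a, a⁻¹)) (fun x => x.1) ?_ ?_ ?_ <;>
      simp +contextual [triV]
    · intro a h
      exact eq_inv_of_mul_eq_one_left h
    · intro a b h h'
      constructor
      · rw [← h, mul_inv_cancel]
      · rw [← h, inv_inv]
  refine (tri_sum triG).trans ?_
  omega

/-- The preference triads on 4 alternatives fall into exactly 111 equivalence classes. -/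
theorem card_quot_prefRel_four : Nat.card (Quot (prefRel 4)) = 111 := by
  classical
  let _ := triAct
  have key (ρ : Equiv.Perm (Fin 3)) (x : Equiv.Perm (Fin 4) × Equiv.Perm (Fin 4)) :
      ρ • x = triN (fun i => triV x (ρ⁻¹ i)) := rfl
  have e : Quot (prefRel 4) ≃ Quotient (MulAction.orbitRel (Equiv.Perm (Fin 3))
      (Equiv.Perm (Fin 4) × Equiv.Perm (Fin 4))) :=
    { toFun := Quot.lift (fun P => Quotient.mk _ (triN P)) (by
        rintro P Q ⟨ρ, τ, h⟩
        symm
        apply Quotient.sound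
        refine ⟨ρ⁻¹, ?_⟩
        change ρ⁻¹ • triN P = triN Q
        rw [key, inv_inv]
        apply triN_mul ((P 0)⁻¹ * τ⁻¹)
        intro i
        rw [triV_triN, h]
        group)
      invFun := Quotient.lift (fun x => Quot.mk _ (triV x)) (by
        rintro x y ⟨ρ, h⟩
        change ρ • y = x at h
        symm
        apply Quot.sound
        refine ⟨ρ⁻¹, (triV y (ρ⁻¹ 0))⁻¹, ?_⟩
        intro i
        rw [← h, key, triV_triN])
      left_inv := by
        rintro ⟨P⟩
        symm
        exact Quot.sound ⟨1, (P 0)⁻¹, fun i => triV_triN P i⟩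
      right_inv := by
        rintro ⟨x⟩
        exact congrArg (Quotient.mk _) (triN_triV x) }
  have b := MulAction.sum_card_fixedBy_eq_card_orbits_mul_card_group (Equiv.Perm (Fin 3))
      (Equiv.Perm (Fin 4) × Equiv.Perm (Fin 4))
  have c : ∑ ρ : Equiv.Perm (Fin 3), Fintype.card (MulAction.fixedBy
      (Equiv.Perm (Fin 4) × Equiv.Perm (Fin 4)) ρ) = 666 := by
    rw [← tri_count]
    refine Finset.sum_congr rfl fun ρ _ => Fintype.card_congr (Equiv.refl _)
  rw [c, Fintype.card_perm, Fintype.card_fin] at b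
  rw [Nat.card_congr e, Nat.card_eq_fintype_card]
  have : Nat.factorial 3 = 6 := rfl
  rw [this] at b
  omega
end
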